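/- Let (φ1, φ2) be an admissible nondecreasing pair. Then there exist sequences of functions (φ_{1,r})_{r≥1}, (φ_{2,r})_{r≥1} and positive reals (M_r)_{r≥1} such that for every r: (φ_{1,r}, φ_{2,r}) is an admissible nondecreasing pair; for l = 1,2, φ_{l,r} is affine on (−∞, −M_r] and affine on [M_r, ∞); φ_{l,r} ≤ φ_l pointwise; and φ_{l,r}(x) → φ_l(x) as r → ∞ for every x ∈ ℝ. -/

import Mathlib

open MeasureTheory Set Filter

/-- `φ` is twice differentiable with bounded first and second derivatives. -/
def TwiceDiffBounded (φ : ℝ → ℝ) : Prop :=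
  Differentiable ℝ φ ∧ Differentiable ℝ (deriv φ) ∧
    (∃ C, ∀ x, |deriv φ x| ≤ C) ∧ (∃ C, ∀ x, |deriv (deriv φ) x| ≤ C)

/-- An admissible nondecreasing pair. -/
def AdmissibleNondecPair (φ1 φ2 : ℝ → ℝ) : Prop :=
  TwiceDiffBounded φ1 ∧ TwiceDiffBounded φ2 ∧
    Monotone φ1 ∧ Monotone φ2 ∧
    ConvexOn ℝ Set.univ φ1 ∧ ConvexOn ℝ Set.univ φ2 ∧
    (∀ x, φ1 x ≤ φ2 x) ∧ (∀ x, deriv φ1 x ≤ deriv φ2 x)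

lemma le_of_hasDerivAt_nonneg {f f' : ℝ → ℝ} (hf : ∀ x, HasDerivAt f (f' x) x) {x y : ℝ}
    (hxy : x ≤ y) (h : ∀ t ∈ Icc x y, 0 ≤ f' t) : f x ≤ f y := by
  refine monotoneOn_of_deriv_nonneg (convex_Icc x y)
    (fun t _ => (hf t).continuousAt.continuousWithinAt)
    (fun t _ => (hf t).differentiableAt.differentiableWithinAt) (fun t ht => ?_)
    (left_mem_Icc.2 hxy) (right_mem_Icc.2 hxy) hxy
  rw [(hf t).deriv]
  exact h t (interior_subset ht)

lemma sub_le_sub_of_hasDerivAt_le {f f' g g' : ℝ → ℝ} (hf : ∀ x, HasDerivAt f (f' x) x)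
    (hg : ∀ x, HasDerivAt g (g' x) x) {x y : ℝ} (hxy : x ≤ y)
    (h : ∀ t ∈ Icc x y, f' t ≤ g' t) : f y - f x ≤ g y - g x := by
  have := le_of_hasDerivAt_nonneg (f := fun t => g t - f t) (fun t => (hg t).sub (hf t)) hxy
    (fun t ht => sub_nonneg.2 (h t ht))
  linarith

lemma sub_eq_sub_of_hasDerivAt_eq {f f' g g' : ℝ → ℝ} (hf : ∀ x, HasDerivAt f (f' x) x)
    (hg : ∀ x, HasDerivAt g (g' x) x) {x y : ℝ} (hxy : x ≤ y)
    (h : ∀ t ∈ Icc x y, f' t = g' t) : f y - f x = g y - g x :=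
  le_antisymm (sub_le_sub_of_hasDerivAt_le hf hg hxy fun t ht => (h t ht).le)
    (sub_le_sub_of_hasDerivAt_le hg hf hxy fun t ht => (h t ht).ge)

lemma hasDerivAt_const_mul_self (A x : ℝ) : HasDerivAt (fun x => A * x) A x := by
  simpa using (hasDerivAt_id x).const_mul A

lemma eq_affine_of_hasDerivAt_eq_right {f f' : ℝ → ℝ} {M A : ℝ}
    (hf : ∀ x, HasDerivAt f (f' x) x) (h : ∀ x, M ≤ x → f' x = A) :
    ∃ A B : ℝ, ∀ x, M ≤ x → f x = A * x + B := by
  refine ⟨A, f M - A * M, fun x hx => ?_⟩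
  have := sub_eq_sub_of_hasDerivAt_eq hf (hasDerivAt_const_mul_self A) hx
    (fun t ht => h t ht.1)
  linarith

lemma eq_affine_of_hasDerivAt_eq_left {f f' : ℝ → ℝ} {M A : ℝ}
    (hf : ∀ x, HasDerivAt f (f' x) x) (h : ∀ x, x ≤ M → f' x = A) :
    ∃ A B : ℝ, ∀ x, x ≤ M → f x = A * x + B := by
  refine ⟨A, f M - A * M, fun x hx => ?_⟩
  have := sub_eq_sub_of_hasDerivAt_eq hf (hasDerivAt_const_mul_self A) hx
    (fun t ht => h t ht.2)
  linarith

lemma hasDerivAt_const_add_integral {g : ℝ → ℝ} (hg : Continuous g) (c x : ℝ) :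
    HasDerivAt (fun x => c + ∫ t in (0 : ℝ)..x, g t) (g x) x :=
  (intervalIntegral.integral_hasDerivAt_right (hg.intervalIntegrable _ _)
    hg.stronglyMeasurable.stronglyMeasurableAtFilter hg.continuousAt).const_add c

lemma TwiceDiffBounded.of_hasDerivAt {f g : ℝ → ℝ} {C K : ℝ} (hf : ∀ x, HasDerivAt f (g x) x)
    (hg : Differentiable ℝ g) (hC : ∀ x, |g x| ≤ C) (hK : ∀ x, |deriv g x| ≤ K) :
    TwiceDiffBounded f := by
  have : deriv f = g := funext fun x => (hf x).deriv
  refine ⟨fun x => (hf x).differentiableAt, ?_, ⟨C, ?_⟩, ⟨K, ?_⟩⟩ <;> rw [this] <;> assumption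

lemma monotone_of_forall_hasDerivAt_nonneg {f g : ℝ → ℝ} (hf : ∀ x, HasDerivAt f (g x) x)
    (h : ∀ x, 0 ≤ g x) : Monotone f :=
  fun _ _ hxy => le_of_hasDerivAt_nonneg hf hxy fun t _ => h t

lemma convexOn_of_hasDerivAt_monotone {f g : ℝ → ℝ} (hf : ∀ x, HasDerivAt f (g x) x)
    (h : Monotone g) : ConvexOn ℝ univ f := by
  have : deriv f = g := funext fun x => (hf x).deriv
  exact Monotone.convexOn_univ_of_deriv (fun x => (hf x).differentiableAt) (this ▸ h)

/-- A differentiable truncation of the identity to a neighbourhood of `[-R, R]`. -/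
lemma exists_differentiable_truncation {R w : ℝ} (hR : 0 ≤ R) (hw : 0 < w) :
    ∃ T k : ℝ → ℝ, (∀ x, HasDerivAt T (k x) x) ∧ (∀ x, 0 ≤ k x) ∧ (∀ x, k x ≤ 1) ∧
      (∀ x, |x| ≤ R → T x = x) ∧ (∀ x, R + w ≤ x → T x = T (R + w)) ∧
      (∀ x, x ≤ -(R + w) → T x = T (-(R + w))) := by
  set k : ℝ → ℝ := fun t => max 0 (min 1 ((R + w - |t|) / w)) with hk
  have hkc : Continuous k := by fun_prop
  set T : ℝ → ℝ := fun x => 0 + ∫ t in (0 : ℝ)..x, k t with hT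
  have hd : ∀ x, HasDerivAt T (k x) x := hasDerivAt_const_add_integral hkc 0
  have hT0 : T 0 = 0 := by simp [hT]
  have hk1 : ∀ t, |t| ≤ R → k t = 1 := fun t ht => by
    have : 1 ≤ (R + w - |t|) / w := by rw [le_div_iff₀ hw]; linarith
    simp [hk, min_eq_left this]
  have hk0 : ∀ t, R + w ≤ |t| → k t = 0 := fun t ht => by
    have : (R + w - |t|) / w ≤ 0 := div_nonpos_of_nonpos_of_nonneg (by linarith) hw.le
    simp only [hk]
    exact max_eq_left ((min_le_right _ _).trans this)
  refine ⟨T, k, hd, fun x => le_max_left _ _, fun x => max_le zero_le_one (min_le_left _ _),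
    fun x hx => ?_, fun x hx => ?_, fun x hx => ?_⟩
  · obtain ⟨h1, h2⟩ := abs_le.1 hx
    rcases le_total 0 x with h | h
    · have := sub_eq_sub_of_hasDerivAt_eq hd (hasDerivAt_id) h
        (fun t ht => hk1 t (abs_le.2 ⟨by linarith [ht.1], ht.2.trans h2⟩))
      simpa [hT0] using this
    · have := sub_eq_sub_of_hasDerivAt_eq hd (hasDerivAt_id) h
        (fun t ht => hk1 t (abs_le.2 ⟨h1.trans ht.1, by linarith [ht.2]⟩))
      simpa [hT0] using this
  · have := sub_eq_sub_of_hasDerivAt_eq hd (fun x => hasDerivAt_const x (0 : ℝ)) hx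
      (fun t ht => hk0 t (ht.1.trans (le_abs_self t)))
    linarith
  · have := sub_eq_sub_of_hasDerivAt_eq hd (fun x => hasDerivAt_const x (0 : ℝ)) hx
      (fun t ht => hk0 t (by linarith [neg_le_abs t, ht.2]))
    linarith

/-- A differentiable increasing transition from `0` to `1` across `[a, b]`. -/
lemma exists_differentiable_transition {a b : ℝ} (hab : a < b) :
    ∃ c : ℝ → ℝ, ∃ K : ℝ, Differentiable ℝ c ∧ Monotone c ∧ (∀ x, |deriv c x| ≤ K) ∧
      (∀ x, 0 ≤ c x) ∧ (∀ x, c x ≤ 1) ∧ (∀ x, x ≤ a → c x = 0) ∧ (∀ x, b ≤ x → c x = 1) := by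
  have hb : 0 < b - a := sub_pos.2 hab
  set c : ℝ → ℝ := fun x => Real.smoothTransition ((x - a) / (b - a)) with hc
  have hs : ContDiff ℝ 1 c := Real.smoothTransition.contDiff.comp (by fun_prop)
  have h0 : ∀ x, x ≤ a → c x = 0 := fun x hx =>
    Real.smoothTransition.zero_of_nonpos
      (div_nonpos_of_nonpos_of_nonneg (by linarith) hb.le)
  have h1 : ∀ x, b ≤ x → c x = 1 := fun x hx =>
    Real.smoothTransition.one_of_one_le (by rw [le_div_iff₀ hb]; linarith)
  obtain ⟨K, hK⟩ := isCompact_Icc.exists_bound_of_continuousOn (s := Icc a b)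
    (hs.continuous_deriv le_rfl).continuousOn
  refine ⟨c, K, hs.differentiable one_ne_zero, fun x y hxy => ?_, fun x => ?_,
    fun x => Real.smoothTransition.nonneg _, fun x => Real.smoothTransition.le_one _, h0, h1⟩
  · exact Real.smoothTransition.monotone (by gcongr)
  · have hK0 : 0 ≤ K := (norm_nonneg _).trans (hK a (left_mem_Icc.2 hab.le))
    rcases lt_or_ge x a with h | h
    · have heq : c =ᶠ[nhds x] fun _ => (0 : ℝ) :=
        (eventually_lt_nhds h).mono fun y hy => h0 y hy.le
      rw [heq.deriv_eq]
      simpa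
    rcases lt_or_ge b x with h' | h'
    · have heq : c =ᶠ[nhds x] fun _ => (1 : ℝ) :=
        (eventually_gt_nhds h').mono fun y hy => h1 y hy.le
      rw [heq.deriv_eq]
      simpa
    exact hK x ⟨h, h'⟩

lemma AdmissibleNondecPair.exists_affine_at_infinity {φ1 φ2 : ℝ → ℝ}
    (h : AdmissibleNondecPair φ1 φ2) {C L R w : ℝ} (hC : ∀ x, |deriv φ2 x| ≤ C)
    (hL : ∀ x, L ≤ φ2 x - φ1 x) (hR : 0 ≤ R) (hw : 0 < w) :
    ∃ (ψ1 ψ2 : ℝ → ℝ) (M : ℝ), 0 < M ∧ AdmissibleNondecPair ψ1 ψ2 ∧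
      (∃ A B : ℝ, ∀ x, M ≤ x → ψ1 x = A * x + B) ∧
      (∃ A B : ℝ, ∀ x, x ≤ -M → ψ1 x = A * x + B) ∧
      (∃ A B : ℝ, ∀ x, M ≤ x → ψ2 x = A * x + B) ∧
      (∃ A B : ℝ, ∀ x, x ≤ -M → ψ2 x = A * x + B) ∧
      (∀ x, ψ1 x ≤ φ1 x) ∧ (∀ x, ψ2 x ≤ φ2 x) ∧
      (∀ x, |x| ≤ R → ψ1 x = φ1 x - (φ2 (-R) - φ1 (-R) - L) - 2 * w * C) ∧
      (∀ x, |x| ≤ R → ψ2 x = φ2 x - (φ2 (-R) - φ1 (-R) - L)) := by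
  obtain ⟨⟨d1, dd1, -, K1, hK1⟩, ⟨d2, dd2, -, K2, hK2⟩, m1, m2, c1, c2, hle, hdle⟩ := h
  have hφ1 : ∀ x, HasDerivAt φ1 (deriv φ1 x) x := fun x => (d1 x).hasDerivAt
  have hφ2 : ∀ x, HasDerivAt φ2 (deriv φ2 x) x := fun x => (d2 x).hasDerivAt
  have md1 : Monotone (deriv φ1) := monotoneOn_univ.1 (c1.monotoneOn_deriv fun x _ => d1 x)
  have md2 : Monotone (deriv φ2) := monotoneOn_univ.1 (c2.monotoneOn_deriv fun x _ => d2 x)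
  have hnn : ∀ x, 0 ≤ deriv φ1 x := fun x => m1.deriv_nonneg
  have hC' : ∀ x, deriv φ2 x ≤ C := fun x => (le_abs_self _).trans (hC x)
  have hC0 : 0 ≤ C := (abs_nonneg _).trans (hC 0)
  obtain ⟨T, k, hT, hk0, hk1, hTid, hTr, hTl⟩ := exists_differentiable_truncation hR hw
  obtain ⟨c, K, dc, mc, hcK, hc0, hc1, hcl, hcr⟩ :=
    exists_differentiable_transition (a := -(R + 2 * w)) (b := -(R + w)) (by linarith)
  have mT : Monotone T := monotone_of_forall_hasDerivAt_nonneg hT hk0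
  have hT0 : T 0 = 0 := hTid 0 (by simpa)
  have hTpos : ∀ x, 0 ≤ x → T x ≤ x := fun x hx => by
    have := sub_le_sub_of_hasDerivAt_le hT hasDerivAt_id hx fun t _ => hk1 t
    simpa [hT0] using this
  have hTneg : ∀ x, x ≤ 0 → x ≤ T x := fun x hx => by
    have := sub_le_sub_of_hasDerivAt_le hT hasDerivAt_id hx fun t _ => hk1 t
    simpa [hT0] using this
  set s := deriv φ1 (T (-(R + w))) with hs
  set g1 : ℝ → ℝ := fun x => deriv φ1 (T x) with hg1
  set g2 : ℝ → ℝ := fun x => s + c x * (deriv φ2 (T x) - s) with hg2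
  have hTge : ∀ x, T (-(R + w)) ≤ T x := fun x => by
    rcases le_total x (-(R + w)) with hx | hx
    · rw [hTl x hx]
    · exact mT hx
  have hs2 : ∀ x, 0 ≤ deriv φ2 (T x) - s := fun x =>
    sub_nonneg.2 ((hdle _).trans (md2 (hTge x)))
  have hdg1 : ∀ x, HasDerivAt g1 (deriv (deriv φ1) (T x) * k x) x := fun x =>
    (dd1 (T x)).hasDerivAt.comp x (hT x)
  have hdg2 : ∀ x, HasDerivAt g2 (deriv c x * (deriv φ2 (T x) - s) +
      c x * (deriv (deriv φ2) (T x) * k x)) x := fun x =>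
    ((dc x).hasDerivAt.mul (((dd2 (T x)).hasDerivAt.comp x (hT x)).sub_const s)).const_add s
  have dg1 : Differentiable ℝ g1 := fun x => (hdg1 x).differentiableAt
  have dg2 : Differentiable ℝ g2 := fun x => (hdg2 x).differentiableAt
  have mg1 : Monotone g1 := md1.comp mT
  have mg2 : Monotone g2 := fun x y hxy => by
    have : c x * (deriv φ2 (T x) - s) ≤ c y * (deriv φ2 (T y) - s) :=
      mul_le_mul (mc hxy) (sub_le_sub_right (md2 (mT hxy)) s) (hs2 x) (hc0 y)
    simp only [hg2]
    linarith
  have hg2eq : ∀ x, -(R + w) ≤ x → g2 x = deriv φ2 (T x) := fun x hx => by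
    simp [hg2, hcr x hx]
  have hg2s : ∀ x, s ≤ g2 x := fun x => by
    have := mul_nonneg (hc0 x) (hs2 x)
    simp only [hg2]
    linarith
  have hg12 : ∀ x, g1 x ≤ g2 x := fun x => by
    rcases le_total x (-(R + w)) with hx | hx
    · simp only [hg1, hTl x hx]
      exact hg2s x
    · rw [hg2eq x hx]
      exact hdle _
  have hg2C : ∀ x, g2 x ≤ C := fun x => by
    have h1 := mul_le_of_le_one_left (hs2 x) (hc1 x)
    have h2 := hC' (T x)
    simp only [hg2]
    linarith
  have hg1nn : ∀ x, 0 ≤ g1 x := fun x => hnn _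
  have hg2nn : ∀ x, 0 ≤ g2 x := fun x => (hg1nn x).trans (hg12 x)
  have hg1l : ∀ x, x ≤ -(R + 2 * w) → g1 x = s := fun x hx => by
    simp only [hg1, hTl x (by linarith), hs]
  have hg2l : ∀ x, x ≤ -(R + 2 * w) → g2 x = s := fun x hx => by simp [hg2, hcl x hx]
  set ε := φ2 (-R) - φ1 (-R) - L with hε
  have hε0 : 0 ≤ ε := sub_nonneg.2 (hL _)
  have hδ0 : 0 ≤ 2 * w * C := by positivity
  set ψ1 : ℝ → ℝ := fun x => (φ1 0 - ε - 2 * w * C) + ∫ t in (0 : ℝ)..x, g1 t with hψ1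
  set ψ2 : ℝ → ℝ := fun x => (φ2 0 - ε) + ∫ t in (0 : ℝ)..x, g2 t with hψ2
  have e1 : ∀ x, HasDerivAt ψ1 (g1 x) x := hasDerivAt_const_add_integral dg1.continuous _
  have e2 : ∀ x, HasDerivAt ψ2 (g2 x) x := hasDerivAt_const_add_integral dg2.continuous _
  have z1 : ψ1 0 = φ1 0 - ε - 2 * w * C := by simp [hψ1]
  have z2 : ψ2 0 = φ2 0 - ε := by simp [hψ2]
  have v1 : ∀ x, |x| ≤ R → ψ1 x = φ1 x - ε - 2 * w * C := fun x hx => by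
    obtain ⟨h1, h2⟩ := abs_le.1 hx
    have key : ∀ t, |t| ≤ R → g1 t = deriv φ1 t := fun t ht => by simp only [hg1, hTid t ht]
    rcases le_total 0 x with h | h
    · have := sub_eq_sub_of_hasDerivAt_eq e1 hφ1 h
        (fun t ht => key t (abs_le.2 ⟨by linarith [ht.1], ht.2.trans h2⟩))
      linarith
    · have := sub_eq_sub_of_hasDerivAt_eq e1 hφ1 h
        (fun t ht => key t (abs_le.2 ⟨h1.trans ht.1, by linarith [ht.2]⟩))
      linarith
  have v2 : ∀ x, |x| ≤ R → ψ2 x = φ2 x - ε := fun x hx => by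
    obtain ⟨h1, h2⟩ := abs_le.1 hx
    have key : ∀ t, |t| ≤ R → g2 t = deriv φ2 t := fun t ht => by
      rw [hg2eq t (by linarith [(abs_le.1 ht).1]), hTid t ht]
    rcases le_total 0 x with h | h
    · have := sub_eq_sub_of_hasDerivAt_eq e2 hφ2 h
        (fun t ht => key t (abs_le.2 ⟨by linarith [ht.1], ht.2.trans h2⟩))
      linarith
    · have := sub_eq_sub_of_hasDerivAt_eq e2 hφ2 h
        (fun t ht => key t (abs_le.2 ⟨h1.trans ht.1, by linarith [ht.2]⟩))
      linarith
  have u1 : ∀ x, ψ1 x ≤ φ1 x := fun x => by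
    rcases le_total 0 x with h | h
    · have := sub_le_sub_of_hasDerivAt_le e1 hφ1 h (fun t ht => md1 (hTpos t ht.1))
      linarith
    · have := sub_le_sub_of_hasDerivAt_le hφ1 e1 h (fun t ht => md1 (hTneg t ht.2))
      linarith
  have u2' : ∀ x, -(R + w) ≤ x → ψ2 x ≤ φ2 x - ε := fun x hx => by
    rcases le_total 0 x with h | h
    · have := sub_le_sub_of_hasDerivAt_le e2 hφ2 h (fun t ht => by
        rw [hg2eq t (by linarith [ht.1])]
        exact md2 (hTpos t ht.1))
      linarith
    · have := sub_le_sub_of_hasDerivAt_le hφ2 e2 h (fun t ht => by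
        rw [hg2eq t (hx.trans ht.1)]
        exact md2 (hTneg t ht.2))
      linarith
  have u2 : ∀ x, ψ2 x ≤ φ2 x := fun x => by
    rcases le_total (-(R + w)) x with h | h
    · linarith [u2' x h]
    · have h1 := sub_le_sub_of_hasDerivAt_le hφ1 e2 h (fun t ht =>
        (md1 (ht.2.trans (hTneg _ (by linarith)))).trans (hg2s t))
      have h2 := sub_le_sub_of_hasDerivAt_le hφ1 hφ2 (show -(R + w) ≤ -R by linarith)
        (fun t _ => hdle t)
      linarith [u2' _ (le_refl (-(R + w))), hL x]
  have hM : ψ1 (-(R + 2 * w)) ≤ ψ2 (-(R + 2 * w)) := by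
    have h1 := sub_le_sub_of_hasDerivAt_le e2 (hasDerivAt_const_mul_self C)
      (show -(R + 2 * w) ≤ -R by linarith) (fun t _ => hg2C t)
    have h2 := le_of_hasDerivAt_nonneg e1 (show -(R + 2 * w) ≤ -R by linarith)
      (fun t _ => hg1nn t)
    have hRR : |(-R)| ≤ R := by rw [abs_neg, abs_of_nonneg hR]
    linarith [v1 _ hRR, v2 _ hRR, hle (-R)]
  have h12 : ∀ x, ψ1 x ≤ ψ2 x := fun x => by
    rcases le_total (-(R + 2 * w)) x with h | h
    · have := sub_le_sub_of_hasDerivAt_le e1 e2 h (fun t _ => hg12 t)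
      linarith
    · have := sub_eq_sub_of_hasDerivAt_eq e1 e2 h
        (fun t ht => (hg1l t ht.2).trans (hg2l t ht.2).symm)
      linarith
  have hkabs : ∀ x, |k x| ≤ 1 := fun x => by rw [abs_of_nonneg (hk0 x)]; exact hk1 x
  have hcabs : ∀ x, |c x| ≤ 1 := fun x => by rw [abs_of_nonneg (hc0 x)]; exact hc1 x
  have hsub : ∀ x, |deriv φ2 (T x) - s| ≤ C := fun x => by
    rw [abs_of_nonneg (hs2 x)]
    linarith [hC' (T x), hnn (T (-(R + w)))]
  have hK1' : ∀ x, |deriv g1 x| ≤ K1 * 1 := fun x => by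
    rw [(hdg1 x).deriv, abs_mul]
    exact mul_le_mul (hK1 _) (hkabs x) (abs_nonneg _) ((abs_nonneg _).trans (hK1 0))
  have hK2' : ∀ x, |deriv g2 x| ≤ K * C + 1 * (K2 * 1) := fun x => by
    rw [(hdg2 x).deriv]
    refine (abs_add_le _ _).trans ?_
    rw [abs_mul, abs_mul, abs_mul]
    have := (abs_nonneg _).trans (hcK x)
    have := (abs_nonneg _).trans (hK2 (T x))
    gcongr
    exacts [hcK x, hsub x, hcabs x, hK2 _, hkabs x]
  refine ⟨ψ1, ψ2, R + 2 * w, by linarith, ⟨?_, ?_, ?_, ?_, ?_, ?_, h12, fun x => ?_⟩,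
    ?_, ?_, ?_, ?_, u1, u2, v1, v2⟩
  · refine TwiceDiffBounded.of_hasDerivAt (C := C) e1 dg1 (fun x => ?_) hK1'
    rw [abs_of_nonneg (hg1nn x)]
    exact (hg12 x).trans (hg2C x)
  · refine TwiceDiffBounded.of_hasDerivAt (C := C) e2 dg2 (fun x => ?_) hK2'
    rw [abs_of_nonneg (hg2nn x)]
    exact hg2C x
  · exact monotone_of_forall_hasDerivAt_nonneg e1 hg1nn
  · exact monotone_of_forall_hasDerivAt_nonneg e2 hg2nn
  · exact convexOn_of_hasDerivAt_monotone e1 mg1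
  · exact convexOn_of_hasDerivAt_monotone e2 mg2
  · rw [(e1 x).deriv, (e2 x).deriv]
    exact hg12 x
  · exact eq_affine_of_hasDerivAt_eq_right e1 (A := deriv φ1 (T (R + w))) fun x hx => by
      simp only [hg1, hTr x (by linarith)]
  · exact eq_affine_of_hasDerivAt_eq_left e1 hg1l
  · exact eq_affine_of_hasDerivAt_eq_right e2 (A := deriv φ2 (T (R + w))) fun x hx => by
      rw [hg2eq x (by linarith), hTr x (by linarith)]
  · exact eq_affine_of_hasDerivAt_eq_left e2 hg2l

theorem approximation_nondec_pair (φ1 φ2 : ℝ → ℝ) (h : AdmissibleNondecPair φ1 φ2) :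
    ∃ (ψ1 ψ2 : ℕ → ℝ → ℝ) (M : ℕ → ℝ),
      (∀ r : ℕ, 0 < M r) ∧
      (∀ r : ℕ, AdmissibleNondecPair (ψ1 r) (ψ2 r)) ∧
      (∀ r : ℕ, ∃ A B : ℝ, ∀ x : ℝ, M r ≤ x → ψ1 r x = A * x + B) ∧
      (∀ r : ℕ, ∃ A B : ℝ, ∀ x : ℝ, x ≤ -M r → ψ1 r x = A * x + B) ∧
      (∀ r : ℕ, ∃ A B : ℝ, ∀ x : ℝ, M r ≤ x → ψ2 r x = A * x + B) ∧
      (∀ r : ℕ, ∃ A B : ℝ, ∀ x : ℝ, x ≤ -M r → ψ2 r x = A * x + B) ∧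
      (∀ r : ℕ, ∀ x : ℝ, ψ1 r x ≤ φ1 x) ∧
      (∀ r : ℕ, ∀ x : ℝ, ψ2 r x ≤ φ2 x) ∧
      (∀ x : ℝ, Tendsto (fun r => ψ1 r x) atTop (nhds (φ1 x))) ∧
      (∀ x : ℝ, Tendsto (fun r => ψ2 r x) atTop (nhds (φ2 x))) := by
  obtain ⟨C, hC⟩ := h.2.1.2.2.1
  have hD : Monotone fun x => φ2 x - φ1 x :=
    monotone_of_forall_hasDerivAt_nonneg (fun x => (h.2.1.1 x).hasDerivAt.sub (h.1.1 x).hasDerivAt)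
      fun x => sub_nonneg.2 (h.2.2.2.2.2.2.2 x)
  have hbdd : BddBelow (range fun x => φ2 x - φ1 x) :=
    ⟨0, forall_mem_range.2 fun x => sub_nonneg.2 (h.2.2.2.2.2.2.1 x)⟩
  set L := ⨅ x, (φ2 x - φ1 x)
  have hL : ∀ x, L ≤ φ2 x - φ1 x := fun x => ciInf_le hbdd x
  have hR : Tendsto (fun r : ℕ => -(r : ℝ)) atTop atBot :=
    tendsto_neg_atTop_atBot.comp tendsto_natCast_atTop_atTop
  have hε : Tendsto (fun r : ℕ => φ2 (-(r : ℝ)) - φ1 (-(r : ℝ)) - L) atTop (nhds 0) := by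
    have := ((tendsto_atBot_ciInf hD hbdd).comp hR).sub_const L
    rwa [sub_self] at this
  have hw : Tendsto (fun r : ℕ => 2 * (1 / ((r : ℝ) + 1)) * C) atTop (nhds 0) := by
    simpa using (tendsto_one_div_add_atTop_nhds_zero_nat (𝕜 := ℝ)).const_mul 2 |>.mul_const C
  choose ψ1 ψ2 M hM hadm a1 b1 a2 b2 u1 u2 v1 v2 using fun r : ℕ =>
    h.exists_affine_at_infinity hC hL (Nat.cast_nonneg r) (Nat.one_div_pos_of_nat (n := r))
  refine ⟨ψ1, ψ2, M, hM, hadm, a1, b1, a2, b2, u1, u2, fun x => ?_, fun x => ?_⟩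
  · have : Tendsto (fun r : ℕ => φ1 x - (φ2 (-(r : ℝ)) - φ1 (-(r : ℝ)) - L) -
        2 * (1 / ((r : ℝ) + 1)) * C) atTop (nhds (φ1 x)) := by
      simpa using (hε.const_sub (φ1 x)).sub hw
    refine this.congr' ?_
    filter_upwards [tendsto_natCast_atTop_atTop.eventually_ge_atTop |x|] with r hr
    exact (v1 r x hr).symm
  · have : Tendsto (fun r : ℕ => φ2 x - (φ2 (-(r : ℝ)) - φ1 (-(r : ℝ)) - L))
        atTop (nhds (φ2 x)) := by
      simpa using hε.const_sub (φ2 x)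
    refine this.congr' ?_
    filter_upwards [tendsto_natCast_atTop_atTop.eventually_ge_atTop |x|] with r hr
    exact (v2 r x hr).symm
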